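/- There exists a nonzero polynomial function p on the 84-dimensional complex vector space ⋀³ℂ⁹ such that for every ω ∈ ⋀³ℂ⁹ with p(ω) ≠ 0 the following holds: for every nonzero linear form ξ ∈ (ℂ⁹)* and every 4-dimensional subspace P₄ ⊆ ker ξ such that the contraction ι_ξ ω lies in the image of ⋀²P₄ in ⋀²ℂ⁹, and for every 1-dimensional subspace V₁ ⊆ P₄, there exist subspaces U₂ ⊆ U₅ ⊆ ℂ⁹ with dim U₂ = 2, dim U₅ = 5, V₁ ⊆ U₂, and ω ∈ U₂∧⋀²ℂ⁹ + ℂ⁹∧⋀²U₅. -/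

import Mathlib

open ExteriorAlgebra

noncomputable section

/-- `V₉ = ℂ⁹`. -/
abbrev V9 : Type := Fin 9 → ℂ

/-- For subspaces `S, T, U` of `W = ℂ⁹`, the subspace `S∧T∧U` of `⋀³W`, realized as the span,
inside the exterior algebra, of all products `s∧t∧u` with `s ∈ S`, `t ∈ T`, `u ∈ U`.
In particular `wSpan S ⊤ ⊤ = S∧⋀²W` and `wSpan ⊤ S S = W∧⋀²S`. -/
def wSpan (S T U : Submodule ℂ V9) : Submodule ℂ (ExteriorAlgebra ℂ V9) :=
  Submodule.span ℂ {x | ∃ s ∈ S, ∃ t ∈ T, ∃ u ∈ U, x = ι ℂ s * ι ℂ t * ι ℂ u}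

/-- For a subspace `S` of `W = ℂ⁹`, the image of `⋀²S` in `⋀²W`, realized as the span,
inside the exterior algebra, of all products `s∧s'` with `s, s' ∈ S`. -/
def wSpan2 (S : Submodule ℂ V9) : Submodule ℂ (ExteriorAlgebra ℂ V9) :=
  Submodule.span ℂ {x | ∃ s ∈ S, ∃ t ∈ S, x = ι ℂ s * ι ℂ t}

/-- A function on a complex vector space is polynomial if it belongs to the subalgebra of
functions generated by the linear forms. -/
def IsPolyFun {W : Type*} [AddCommGroup W] [Module ℂ W] (p : W → ℂ) : Prop :=
  p ∈ Algebra.adjoin ℂ (Set.range fun φ : Module.Dual ℂ W => (φ : W → ℂ))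

section TrilinearForms

variable {D : Type*} [AddCommGroup D] [Module ℂ D]

/-- A trilinear form is alternating if it vanishes whenever two adjacent arguments agree. -/
structure IsAlternatingForm (f : D →ₗ[ℂ] D →ₗ[ℂ] D →ₗ[ℂ] ℂ) : Prop where
  left : ∀ x z, f x x z = 0
  right : ∀ x y, f x y y = 0

variable {f : D →ₗ[ℂ] D →ₗ[ℂ] D →ₗ[ℂ] ℂ}

namespace IsAlternatingForm

theorem swap_left (hf : IsAlternatingForm f) (x y z : D) : f x y z = -f y x z := by
  have h := hf.left (x + y) z
  simp only [map_add, LinearMap.add_apply, hf.left] at h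
  linear_combination h

theorem swap_right (hf : IsAlternatingForm f) (x y z : D) : f x y z = -f x z y := by
  have h := hf.right x (y + z)
  simp only [map_add, LinearMap.add_apply, hf.right] at h
  linear_combination h

theorem rotate (hf : IsAlternatingForm f) (x y z : D) : f x y z = f y z x := by
  rw [hf.swap_left, hf.swap_right, neg_neg]

theorem outer (hf : IsAlternatingForm f) (x y : D) : f x y x = 0 := by
  rw [hf.swap_right, hf.left, neg_zero]

theorem perm_eq_zero (hf : IsAlternatingForm f) {x y z : D} (h : f x y z = 0) :
    f y x z = 0 ∧ f x z y = 0 ∧ f z y x = 0 ∧ f y z x = 0 ∧ f z x y = 0 := by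
  have h₁ : f y z x = 0 := by rw [← hf.rotate, h]
  have h₂ : f z x y = 0 := by rw [hf.rotate, h]
  exact ⟨by rw [hf.swap_left, h, neg_zero], by rw [hf.swap_right, h, neg_zero],
    by rw [hf.swap_right, h₂, neg_zero], h₁, h₂⟩

end IsAlternatingForm

/-- The vectors `k, l₁, …, l₄` span `K`, and on `K` the form `f` is `θ ∧ σ`, where `θ` is the
coordinate of `k` and `σ = l₁* ∧ l₂* + l₃* ∧ l₄*`. -/
structure IsNormalForm (f : D →ₗ[ℂ] D →ₗ[ℂ] D →ₗ[ℂ] ℂ) (K : Submodule ℂ D)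
    (k l₁ l₂ l₃ l₄ : D) : Prop where
  mem_k : k ∈ K
  mem₁ : l₁ ∈ K
  mem₂ : l₂ ∈ K
  mem₃ : l₃ ∈ K
  mem₄ : l₄ ∈ K
  le_span : K ≤ Submodule.span ℂ {k, l₁, l₂, l₃, l₄}
  k12 : f k l₁ l₂ = 1
  k34 : f k l₃ l₄ = 1
  k13 : f k l₁ l₃ = 0
  k14 : f k l₁ l₄ = 0
  k23 : f k l₂ l₃ = 0
  k24 : f k l₂ l₄ = 0
  l123 : f l₁ l₂ l₃ = 0
  l124 : f l₁ l₂ l₄ = 0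
  l134 : f l₁ l₃ l₄ = 0
  l234 : f l₂ l₃ l₄ = 0

namespace IsNormalForm

variable {K : Submodule ℂ D} {k l₁ l₂ l₃ l₄ : D}

theorem rotate₁₂ (hf : IsAlternatingForm f) (h : IsNormalForm f K k l₁ l₂ l₃ l₄) :
    IsNormalForm f K k l₂ (-l₁) l₃ l₄ where
  mem_k := h.mem_k
  mem₁ := h.mem₂
  mem₂ := neg_mem h.mem₁
  mem₃ := h.mem₃
  mem₄ := h.mem₄
  le_span := h.le_span.trans <| Submodule.span_le.2 <| by
    have hs : -(-l₁) ∈ Submodule.span ℂ {k, l₂, -l₁, l₃, l₄} :=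
      neg_mem (Submodule.subset_span (by simp))
    rw [neg_neg] at hs
    rintro x (rfl | rfl | rfl | rfl | rfl)
    · exact Submodule.subset_span (by simp)
    · exact hs
    all_goals exact Submodule.subset_span (by simp)
  k12 := by rw [map_neg, hf.swap_right, neg_neg, h.k12]
  k34 := h.k34
  k13 := h.k23
  k14 := h.k24
  k23 := by simp [h.k13]
  k24 := by simp [h.k14]
  l123 := by simp [hf.swap_left l₂, h.l123]
  l124 := by simp [hf.swap_left l₂, h.l124]
  l134 := h.l234
  l234 := by simp [h.l134]

theorem swap_pairs (hf : IsAlternatingForm f) (h : IsNormalForm f K k l₁ l₂ l₃ l₄) :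
    IsNormalForm f K k l₃ l₄ l₁ l₂ where
  mem_k := h.mem_k
  mem₁ := h.mem₃
  mem₂ := h.mem₄
  mem₃ := h.mem₁
  mem₄ := h.mem₂
  le_span := h.le_span.trans <| Submodule.span_mono <| by
    rintro x (rfl | rfl | rfl | rfl | rfl) <;> simp
  k12 := h.k34
  k34 := h.k12
  k13 := by rw [hf.swap_right, h.k13, neg_zero]
  k14 := by rw [hf.swap_right, h.k23, neg_zero]
  k23 := by rw [hf.swap_right, h.k14, neg_zero]
  k24 := by rw [hf.swap_right, h.k24, neg_zero]
  l123 := by rw [← hf.rotate, h.l134]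
  l124 := by rw [← hf.rotate, h.l234]
  l134 := by rw [hf.rotate, h.l123]
  l234 := by rw [hf.rotate, h.l124]

/-- A trilinear form vanishes on `K` in its last argument once it does so on the spanning
vectors. -/
theorem eq_zero (h : IsNormalForm f K k l₁ l₂ l₃ l₄) (g : D →ₗ[ℂ] ℂ) (hk : g k = 0)
    (h₁ : g l₁ = 0) (h₂ : g l₂ = 0) (h₃ : g l₃ = 0) (h₄ : g l₄ = 0) {z : D} (hz : z ∈ K) :
    g z = 0 := by
  have : K ≤ LinearMap.ker g := h.le_span.trans <| Submodule.span_le.2 <| by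
    rintro x (rfl | rfl | rfl | rfl | rfl) <;> simpa
  exact this hz

theorem exists_pair_of_ne_zero (hf : IsAlternatingForm f) (h : IsNormalForm f K k l₁ l₂ l₃ l₄)
    {v : D} (hk₁ : f v k l₁ = 0) (hk₂ : f v k l₂ = 0) (hk₃ : f v k l₃ = 0) (hk₄ : f v k l₄ = 0)
    (htr : f v l₃ l₄ = -f v l₁ l₂)
    (hpf : f v l₁ l₂ ^ 2 = f v l₁ l₄ * f v l₂ l₃ - f v l₁ l₃ * f v l₂ l₄)
    (hne : f v l₁ l₃ ≠ 0) :
    ∃ r₁ ∈ K, ∃ r₂ ∈ K, LinearIndependent ℂ ![r₁, r₂] ∧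
      ∀ z ∈ K, f r₁ r₂ z = 0 ∧ f v r₁ z = 0 ∧ f v r₂ z = 0 := by
  have s21 := hf.swap_right v l₂ l₁
  have s31 := hf.swap_right v l₃ l₁
  have s41 := hf.swap_right v l₄ l₁
  have s32 := hf.swap_right v l₃ l₂
  have s42 := hf.swap_right v l₄ l₂
  have s43 := hf.swap_right v l₄ l₃
  have m₁ := hf.swap_right v l₁ k
  have m₂ := hf.swap_right v l₂ k
  have m₃ := hf.swap_right v l₃ k
  have m₄ := hf.swap_right v l₄ k
  let r₁ := l₂ - (f v l₂ l₃ / f v l₁ l₃) • l₁ - (f v l₁ l₂ / f v l₁ l₃) • l₃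
  let r₂ := l₄ - (f v l₁ l₂ / f v l₁ l₃) • l₁ - (f v l₁ l₄ / f v l₁ l₃) • l₃
  have hr₁ : r₁ ∈ K := sub_mem (sub_mem h.mem₂ (K.smul_mem _ h.mem₁)) (K.smul_mem _ h.mem₃)
  have hr₂ : r₂ ∈ K := sub_mem (sub_mem h.mem₄ (K.smul_mem _ h.mem₁)) (K.smul_mem _ h.mem₃)
  have k21 : f k l₂ l₁ = -1 := by rw [hf.swap_right, h.k12]
  have k31 : f k l₃ l₁ = 0 := by rw [hf.swap_right, h.k13, neg_zero]
  have k41 : f k l₄ l₁ = 0 := by rw [hf.swap_right, h.k14, neg_zero]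
  have k43 : f k l₄ l₃ = -1 := by rw [hf.swap_right, h.k34]
  have hσ : f k r₁ r₂ = 0 := by
    simp only [r₁, r₂, map_sub, map_smul, LinearMap.sub_apply, LinearMap.smul_apply, smul_eq_mul,
      hf.right, k21, k31, h.k14, h.k13, h.k34, h.k23, h.k24]
    ring
  refine ⟨r₁, hr₁, r₂, hr₂, LinearIndependent.pair_iff.2 fun a b hab => ?_, fun z hz => ?_⟩
  · have e₁ := congrArg (fun x => f k x l₁) hab
    have e₂ := congrArg (fun x => f k x l₃) hab
    simp only [r₁, r₂, map_sub, map_add, map_smul, LinearMap.sub_apply, LinearMap.add_apply,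
      LinearMap.smul_apply, smul_eq_mul, hf.right, k21, k31, k41, k43, h.k13, h.k23, map_zero,
      LinearMap.zero_apply] at e₁ e₂
    exact ⟨by linear_combination -e₁, by linear_combination -e₂⟩
  refine ⟨h.eq_zero (f r₁ r₂) (by rw [← hf.rotate, hσ]) ?_ ?_ ?_ ?_ hz,
    h.eq_zero (f v r₁) ?_ ?_ ?_ ?_ ?_ hz, h.eq_zero (f v r₂) ?_ ?_ ?_ ?_ ?_ hz⟩
  iterate 4
    simp only [r₁, r₂, map_sub, map_smul, LinearMap.sub_apply, LinearMap.smul_apply, smul_eq_mul,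
      hf.right, hf.left, hf.outer, h.l134, h.l234, hf.perm_eq_zero h.l123,
      hf.perm_eq_zero h.l124, hf.perm_eq_zero h.l134, hf.perm_eq_zero h.l234]
    ring
  all_goals
    simp only [r₁, r₂, map_sub, map_smul, LinearMap.sub_apply, LinearMap.smul_apply, smul_eq_mul,
      hf.right, s21, s31, s41, s32, s42, s43, m₁, m₂, m₃, m₄, hk₁, hk₂, hk₃, hk₄, htr]
    field_simp
    first | ring1 | linear_combination hpf | linear_combination -hpf

theorem exists_pair (hf : IsAlternatingForm f) (h : IsNormalForm f K k l₁ l₂ l₃ l₄)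
    {v : D} (hk₁ : f v k l₁ = 0) (hk₂ : f v k l₂ = 0) (hk₃ : f v k l₃ = 0) (hk₄ : f v k l₄ = 0)
    (htr : f v l₃ l₄ = -f v l₁ l₂)
    (hpf : f v l₁ l₂ ^ 2 = f v l₁ l₄ * f v l₂ l₃ - f v l₁ l₃ * f v l₂ l₄) :
    ∃ r₁ ∈ K, ∃ r₂ ∈ K, LinearIndependent ℂ ![r₁, r₂] ∧
      ∀ z ∈ K, f r₁ r₂ z = 0 ∧ f v r₁ z = 0 ∧ f v r₂ z = 0 := by
  have s21 := hf.swap_right v l₂ l₁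
  have s41 := hf.swap_right v l₄ l₁
  have s32 := hf.swap_right v l₃ l₂
  have s43 := hf.swap_right v l₄ l₃
  have s31 := hf.swap_right v l₃ l₁
  have s42 := hf.swap_right v l₄ l₂
  by_cases h13 : f v l₁ l₃ = 0
  swap
  · exact h.exists_pair_of_ne_zero hf hk₁ hk₂ hk₃ hk₄ htr hpf h13
  by_cases h23 : f v l₂ l₃ = 0
  swap
  · refine (h.rotate₁₂ hf).exists_pair_of_ne_zero hf hk₂ ?_ hk₃ hk₄ ?_ ?_ h23 <;>
      simp only [map_neg, LinearMap.neg_apply, hk₁, neg_zero, htr, s21, neg_neg]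
    linear_combination hpf
  by_cases h14 : f v l₁ l₄ = 0
  swap
  · refine ((h.swap_pairs hf).rotate₁₂ hf).exists_pair_of_ne_zero hf hk₄ ?_ hk₁ hk₂ ?_ ?_ ?_ <;>
      simp only [map_neg, LinearMap.neg_apply, hk₃, neg_zero, htr, s43, s41, s32, s31, s42, neg_neg]
    · linear_combination hpf
    · simpa using h14
  by_cases h24 : f v l₂ l₄ = 0
  swap
  · refine ((((h.swap_pairs hf).rotate₁₂ hf).swap_pairs hf).rotate₁₂ hf).exists_pair_of_ne_zero hf
      hk₂ ?_ hk₄ ?_ ?_ ?_ h24 <;>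
      simp only [map_neg, LinearMap.neg_apply, hk₁, hk₃, neg_zero, htr, s43, s21, neg_neg]
    linear_combination hpf
  have h12 : f v l₁ l₂ = 0 := by simpa [h13, h14] using hpf
  have h34 : f v l₃ l₄ = 0 := by rw [htr, h12, neg_zero]
  refine ⟨l₁, h.mem₁, l₃, h.mem₃, LinearIndependent.pair_iff.2 fun a b hab => ?_, fun z hz =>
    ⟨h.eq_zero _ ?_ ?_ ?_ ?_ ?_ hz, h.eq_zero _ ?_ ?_ ?_ ?_ ?_ hz, h.eq_zero _ ?_ ?_ ?_ ?_ ?_ hz⟩⟩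
  · have e₁ := congrArg (fun x => f k x l₂) hab
    have e₂ := congrArg (fun x => f k x l₄) hab
    simp only [map_add, map_smul, LinearMap.add_apply, LinearMap.smul_apply, smul_eq_mul, h.k12,
      hf.perm_eq_zero h.k23, h.k14, h.k34, map_zero, LinearMap.zero_apply] at e₁ e₂
    exact ⟨by linear_combination e₁, by linear_combination e₂⟩
  all_goals simp only [hf.right, hf.outer, hf.perm_eq_zero h.k13, hf.perm_eq_zero h.l123,
    h.l134, h13, h12, h14, hf.perm_eq_zero h13, hf.perm_eq_zero h23, h34, hf.perm_eq_zero hk₁,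
    hf.perm_eq_zero hk₃]

/-- If the quadratic condition on `p` holds, `f` restricted to `K + ℂp` degenerates. -/
theorem exists_triple (hf : IsAlternatingForm f) (h : IsNormalForm f K k l₁ l₂ l₃ l₄)
    {p : D} (hk₁ : f p k l₁ = 0) (hk₂ : f p k l₂ = 0) (hk₃ : f p k l₃ = 0) (hk₄ : f p k l₄ = 0)
    (hpf : (f p l₁ l₂ - f p l₃ l₄) ^ 2 + 4 * (f p l₁ l₃ * f p l₂ l₄ - f p l₁ l₄ * f p l₂ l₃) = 0) :
    ∃ r₁ ∈ K, ∃ r₂ ∈ K, ∃ v, LinearIndependent ℂ ![r₁, r₂] ∧ v - p ∈ K ∧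
      ∀ z, z ∈ K ∨ z = p → f r₁ r₂ z = 0 ∧ f v r₁ z = 0 ∧ f v r₂ z = 0 := by
  let c := (f p l₁ l₂ + f p l₃ l₄) / 2
  obtain ⟨r₁, hr₁, r₂, hr₂, hr, H⟩ := h.exists_pair (v := p - c • k) hf (by simp [hk₁, hf.left])
    (by simp [hk₂, hf.left]) (by simp [hk₃, hf.left]) (by simp [hk₄, hf.left])
    (by simp [h.k12, h.k34, c]; ring)
    (by
      simp only [map_sub, map_smul, LinearMap.sub_apply, LinearMap.smul_apply, smul_eq_mul, h.k12,
        h.k13, h.k14, h.k23, h.k24, c]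
      linear_combination hpf / 4)
  have hv : p = (p - c • k) + c • k := by abel
  refine ⟨r₁, hr₁, r₂, hr₂, p - c • k, hr, by simpa using K.smul_mem c h.mem_k, ?_⟩
  rintro z (hz | hz)
  · exact H z hz
  generalize p - c • k = v at hv H
  rw [hz, hv]
  simp only [map_add, map_smul, hf.outer, (H k h.mem_k).1, (H k h.mem_k).2.1, (H k h.mem_k).2.2,
    smul_zero, add_zero, and_true]
  rw [← hf.rotate, (H r₂ hr₂).2.1]

end IsNormalForm

/-- A binary quadratic form over `ℂ` has a nontrivial zero. -/
theorem exists_binary_quadratic_zero (a b c : ℂ) :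
    ∃ s t : ℂ, ¬(s = 0 ∧ t = 0) ∧ a * s ^ 2 + b * (s * t) + c * t ^ 2 = 0 := by
  by_cases ha : a = 0
  · exact ⟨1, 0, by simp, by simp [ha]⟩
  obtain ⟨w, hw⟩ := IsAlgClosed.exists_pow_nat_eq (discrim a b c) (n := 2) two_pos
  refine ⟨(-b + w) / (2 * a), 1, by simp, ?_⟩
  rw [discrim] at hw
  field_simp
  linear_combination hw

theorem IsNormalForm.exists_degenerate (hf : IsAlternatingForm f) {K : Submodule ℂ D}
    {k l₁ l₂ l₃ l₄ : D} (h : IsNormalForm f K k l₁ l₂ l₃ l₄) (p q : D) :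
    ∃ s t : ℂ, ¬(s = 0 ∧ t = 0) ∧ ∃ u, u - (s • p + t • q) ∈ K ∧
      ∃ r₁ ∈ K, ∃ r₂ ∈ K, ∃ v, LinearIndependent ℂ ![r₁, r₂] ∧ v - u ∈ K ∧
        ∀ z, z ∈ K ∨ z = u → f r₁ r₂ z = 0 ∧ f v r₁ z = 0 ∧ f v r₂ z = 0 := by
  have key : ∀ p : D, ∃ p', p' - p ∈ K ∧ f p' k l₁ = 0 ∧ f p' k l₂ = 0 ∧ f p' k l₃ = 0 ∧
      f p' k l₄ = 0 := by
    intro p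
    have k21 := hf.swap_left l₂ k l₁
    have k12 := hf.swap_left l₁ k l₂
    have k34 := hf.swap_left l₃ k l₄
    have k43 := hf.swap_left l₄ k l₃
    rw [hf.swap_right k, h.k12, neg_neg] at k21
    rw [hf.swap_right k, h.k34, neg_neg] at k43
    rw [h.k12] at k12
    rw [h.k34] at k34
    refine ⟨p + ((f p k l₂) • l₁ - (f p k l₁) • l₂ + (f p k l₄) • l₃ - (f p k l₃) • l₄), ?_, ?_⟩
    · rw [add_sub_cancel_left]
      exact sub_mem (add_mem (sub_mem (K.smul_mem _ h.mem₁) (K.smul_mem _ h.mem₂))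
        (K.smul_mem _ h.mem₃)) (K.smul_mem _ h.mem₄)
    · simp [hf.outer, k12, k21, k34, k43, hf.perm_eq_zero h.k13, hf.perm_eq_zero h.k14,
        hf.perm_eq_zero h.k23, hf.perm_eq_zero h.k24]
  obtain ⟨p', hp, p₁, p₂, p₃, p₄⟩ := key p
  obtain ⟨q', hq, q₁, q₂, q₃, q₄⟩ := key q
  obtain ⟨s, t, hst, h0⟩ := exists_binary_quadratic_zero
    ((f p' l₁ l₂ - f p' l₃ l₄) ^ 2 + 4 * (f p' l₁ l₃ * f p' l₂ l₄ - f p' l₁ l₄ * f p' l₂ l₃))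
    (2 * (f p' l₁ l₂ - f p' l₃ l₄) * (f q' l₁ l₂ - f q' l₃ l₄)
      + 4 * (f p' l₁ l₃ * f q' l₂ l₄ + f q' l₁ l₃ * f p' l₂ l₄
        - f p' l₁ l₄ * f q' l₂ l₃ - f q' l₁ l₄ * f p' l₂ l₃))
    ((f q' l₁ l₂ - f q' l₃ l₄) ^ 2 + 4 * (f q' l₁ l₃ * f q' l₂ l₄ - f q' l₁ l₄ * f q' l₂ l₃))
  refine ⟨s, t, hst, s • p' + t • q', ?_, h.exists_triple hf (by simp [p₁, q₁]) (by simp [p₂, q₂])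
    (by simp [p₃, q₃]) (by simp [p₄, q₄]) ?_⟩
  · have := add_mem (K.smul_mem s hp) (K.smul_mem t hq)
    convert this using 1
    module
  · simp only [map_add, map_smul, LinearMap.add_apply, LinearMap.smul_apply, smul_eq_mul]
    linear_combination h0

theorem linearIndependent_pair_of_ne {ι : Type*} {v : ι → D} (hv : LinearIndependent ℂ v) {i j : ι}
    (hij : i ≠ j) : LinearIndependent ℂ ![v i, v j] := by
  have h := hv.comp ![i, j] fun a b hab => by
    fin_cases a <;> fin_cases b <;> simp_all [hij.symm]
  have e : v ∘ ![i, j] = ![v i, v j] := by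
    ext a
    fin_cases a <;> rfl
  rwa [e] at h

/-- Three vectors of a five-dimensional space with `f x m n = 1` have a complement all of whose
vectors are orthogonal to pairs among the three. -/
theorem IsAlternatingForm.exists_orthogonal_pair (hf : IsAlternatingForm f) {K : Submodule ℂ D}
    (hK : Module.finrank ℂ K = 5) {x m n : D} (hx : x ∈ K) (hm : m ∈ K) (hn : n ∈ K)
    (h : f x m n = 1) :
    ∃ r₁ ∈ K, ∃ r₂ ∈ K, LinearIndependent ℂ ![r₁, r₂] ∧
      (f x m r₁ = 0 ∧ f m n r₁ = 0 ∧ f n x r₁ = 0) ∧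
      (f x m r₂ = 0 ∧ f m n r₂ = 0 ∧ f n x r₂ = 0) ∧
      K ≤ Submodule.span ℂ {x, m, n, r₁, r₂} := by
  have : FiniteDimensional ℂ K := Module.finite_of_finrank_pos (by omega)
  let g : K →ₗ[ℂ] Fin 3 → ℂ := LinearMap.pi ![(f x m).comp K.subtype, (f m n).comp K.subtype,
    (f n x).comp K.subtype]
  have h' : f m n x = 1 := by rw [← hf.rotate, h]
  have h'' : f n x m = 1 := by rw [hf.rotate, h]
  have hg : Function.Surjective g := fun w =>
    ⟨w 1 • ⟨x, hx⟩ + w 2 • ⟨m, hm⟩ + w 0 • ⟨n, hn⟩, by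
      ext i
      fin_cases i <;> simp [g, h, h', h'', hf.outer, hf.right]⟩
  have hker : Module.finrank ℂ (LinearMap.ker g) = 2 := by
    have := g.finrank_range_add_finrank_ker
    rw [LinearMap.range_eq_top.2 hg, finrank_top, hK, Module.finrank_fin_fun] at this
    omega
  let b := Module.finBasisOfFinrankEq ℂ _ hker
  have hb : ∀ i, f x m (b i) = 0 ∧ f m n (b i) = 0 ∧ f n x (b i) = 0 := fun i =>
    have hi := LinearMap.mem_ker.1 (b i).2
    ⟨congrFun hi 0, congrFun hi 1, congrFun hi 2⟩
  refine ⟨b 0, (b 0).1.2, b 1, (b 1).1.2, ?_, hb 0, hb 1, fun y hy => ?_⟩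
  · have hli := b.linearIndependent.map' (K.subtype.comp (LinearMap.ker g).subtype)
      (LinearMap.ker_eq_bot.2 (K.injective_subtype.comp (LinearMap.ker g).injective_subtype))
    exact linearIndependent_pair_of_ne hli zero_ne_one
  · let y' : K := ⟨y, hy⟩ - (f m n y • ⟨x, hx⟩ + f n x y • ⟨m, hm⟩ + f x m y • ⟨n, hn⟩)
    have hy' : y' ∈ LinearMap.ker g := by
      rw [LinearMap.mem_ker]
      ext i
      fin_cases i <;> simp [g, y', h, h', h'', hf.outer, hf.right]
    have e := congrArg (fun z : LinearMap.ker g => ((z : K) : D)) (b.sum_repr ⟨y', hy'⟩)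
    simp only [Fin.sum_univ_two, Submodule.coe_add, Submodule.coe_smul, y', Submodule.coe_sub] at e
    rw [eq_sub_iff_add_eq] at e
    rw [← e]
    have hs : ∀ z ∈ ({x, m, n, (b 0 : D), (b 1 : D)} : Set D), ∀ c : ℂ,
        c • z ∈ Submodule.span ℂ {x, m, n, (b 0 : D), (b 1 : D)} :=
      fun z hz c => Submodule.smul_mem _ c (Submodule.subset_span hz)
    refine add_mem (add_mem ?_ ?_) (add_mem (add_mem ?_ ?_) ?_) <;> apply hs <;> simp

theorem IsAlternatingForm.exists_isNormalForm_of_ne_zero (hf : IsAlternatingForm f)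
    {K : Submodule ℂ D} {x m n r₁ r₂ : D} (hx : x ∈ K) (hm : m ∈ K) (hn : n ∈ K)
    (hr₁ : r₁ ∈ K) (hr₂ : r₂ ∈ K) (h : f x m n = 1)
    (h₁ : f x m r₁ = 0 ∧ f m n r₁ = 0 ∧ f n x r₁ = 0)
    (h₂ : f x m r₂ = 0 ∧ f m n r₂ = 0 ∧ f n x r₂ = 0)
    (hs : K ≤ Submodule.span ℂ {x, m, n, r₁, r₂}) (hne : f x r₁ r₂ ≠ 0) :
    ∃ k l₁ l₂ l₃ l₄, IsNormalForm f K k l₁ l₂ l₃ l₄ := by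
  obtain ⟨a₁, b₁, c₁⟩ := h₁
  obtain ⟨a₂, b₂, c₂⟩ := h₂
  have a₁' := (hf.perm_eq_zero a₁).1
  have a₂' := (hf.perm_eq_zero a₂).1
  have c₁' := (hf.perm_eq_zero c₁).1
  have c₂' := (hf.perm_eq_zero c₂).1
  set A := f x r₁ r₂ with hA
  set B := f m r₁ r₂ with hB
  set C := f n r₁ r₂ with hC
  refine ⟨A⁻¹ • x, m - (B / A) • x, A • n - C • x, r₁, r₂,
    K.smul_mem _ hx, sub_mem hm (K.smul_mem _ hx), sub_mem (K.smul_mem _ hn) (K.smul_mem _ hx),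
    hr₁, hr₂, hs.trans (Submodule.span_le.2 ?_), ?_, ?_, ?_, ?_, ?_, ?_, ?_, ?_, ?_, ?_⟩
  · set S : Set D := {A⁻¹ • x, m - (B / A) • x, A • n - C • x, r₁, r₂} with hS
    have hx' : x ∈ Submodule.span ℂ S := by
      have : A • A⁻¹ • x ∈ Submodule.span ℂ S :=
        Submodule.smul_mem _ _ (Submodule.subset_span (by simp [hS]))
      rwa [smul_inv_smul₀ hne] at this
    rintro z (rfl | rfl | rfl | rfl | rfl)
    · exact hx'
    · have : (z - (B / A) • x) + (B / A) • x ∈ Submodule.span ℂ S :=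
        add_mem (Submodule.subset_span (by simp [hS])) (Submodule.smul_mem _ _ hx')
      simpa using this
    · have : A⁻¹ • ((A • z - C • x) + C • x) ∈ Submodule.span ℂ S :=
        Submodule.smul_mem _ _
          (add_mem (Submodule.subset_span (by simp [hS])) (Submodule.smul_mem _ _ hx'))
      rwa [sub_add_cancel, inv_smul_smul₀ hne] at this
    all_goals exact Submodule.subset_span (by simp [hS])
  all_goals
    simp only [map_sub, map_smul, LinearMap.sub_apply, LinearMap.smul_apply, smul_eq_mul,
      hf.left, hf.outer, h, ← hA, ← hB, ← hC, a₁, a₁', b₁, c₁', a₂, a₂', b₂, c₂']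
    field_simp
    try ring1

/-- Three-forms in five variables: either a plane lies in the radical, or there is a normal
form. -/
theorem IsAlternatingForm.exists_radical_or_isNormalForm (hf : IsAlternatingForm f)
    {K : Submodule ℂ D} (hK : Module.finrank ℂ K = 5) :
    (∃ r₁ ∈ K, ∃ r₂ ∈ K, LinearIndependent ℂ ![r₁, r₂] ∧
      ∀ y ∈ K, ∀ z ∈ K, f r₁ y z = 0 ∧ f r₂ y z = 0) ∨
    ∃ k l₁ l₂ l₃ l₄, IsNormalForm f K k l₁ l₂ l₃ l₄ := by
  by_cases h0 : ∀ x ∈ K, ∀ y ∈ K, ∀ z ∈ K, f x y z = 0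
  · left
    have : FiniteDimensional ℂ K := Module.finite_of_finrank_pos (by omega)
    let b := Module.finBasisOfFinrankEq ℂ _ hK
    refine ⟨b 0, (b 0).2, b 1, (b 1).2, ?_, fun y hy z hz =>
      ⟨h0 _ (b 0).2 y hy z hz, h0 _ (b 1).2 y hy z hz⟩⟩
    exact linearIndependent_pair_of_ne
      (b.linearIndependent.map' K.subtype (LinearMap.ker_eq_bot.2 K.injective_subtype))
      zero_ne_one
  push Not at h0
  obtain ⟨x₀, hx₀, m, hm, n, hn, hne⟩ := h0
  obtain ⟨x, hx, h⟩ : ∃ x ∈ K, f x m n = 1 :=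
    ⟨(f x₀ m n)⁻¹ • x₀, K.smul_mem _ hx₀, by simp [hne]⟩
  have h' : f m n x = 1 := by rw [← hf.rotate, h]
  have h'' : f n x m = 1 := by rw [hf.rotate, h]
  obtain ⟨r₁, hr₁, r₂, hr₂, hr, h₁, h₂, hs⟩ := hf.exists_orthogonal_pair hK hx hm hn h
  by_cases hA : f x r₁ r₂ = 0
  swap
  · exact .inr (hf.exists_isNormalForm_of_ne_zero hx hm hn hr₁ hr₂ h h₁ h₂ hs hA)
  have hrot : ∀ x m n : D, ({x, m, n, r₁, r₂} : Set D) = {m, n, x, r₁, r₂} := by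
    intro x m n
    rw [Set.insert_comm x m, Set.insert_comm x n]
  obtain ⟨a₁, b₁, c₁⟩ := h₁
  obtain ⟨a₂, b₂, c₂⟩ := h₂
  by_cases hB : f m r₁ r₂ = 0
  swap
  · exact .inr (hf.exists_isNormalForm_of_ne_zero hm hn hx hr₁ hr₂ h' ⟨b₁, c₁, a₁⟩ ⟨b₂, c₂, a₂⟩
      (hrot x m n ▸ hs) hB)
  by_cases hC : f n r₁ r₂ = 0
  swap
  · exact .inr (hf.exists_isNormalForm_of_ne_zero hn hx hm hr₁ hr₂ h'' ⟨c₁, a₁, b₁⟩ ⟨c₂, a₂, b₂⟩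
      (hrot m n x ▸ hrot x m n ▸ hs) hC)
  left
  have hle : ∀ g : D →ₗ[ℂ] ℂ, g x = 0 → g m = 0 → g n = 0 → g r₁ = 0 → g r₂ = 0 →
      ∀ z ∈ K, g z = 0 := fun g _ _ _ _ _ z hz => by
    have : K ≤ LinearMap.ker g := hs.trans <| Submodule.span_le.2 <| by
      rintro x (rfl | rfl | rfl | rfl | rfl) <;> simpa
    exact this hz
  refine ⟨r₁, hr₁, r₂, hr₂, hr, fun y hy z hz => ⟨hle (f r₁ y) ?_ ?_ ?_ ?_ ?_ z hz,
    hle (f r₂ y) ?_ ?_ ?_ ?_ ?_ z hz⟩⟩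
  all_goals
    rw [hf.swap_right, neg_eq_zero]
    refine hle _ ?_ ?_ ?_ ?_ ?_ y hy
  all_goals simp only [hf.left, hf.right, hf.outer, hf.perm_eq_zero a₁, hf.perm_eq_zero b₁,
    hf.perm_eq_zero c₁, hf.perm_eq_zero a₂, hf.perm_eq_zero b₂, hf.perm_eq_zero c₂,
    hf.perm_eq_zero hA, hf.perm_eq_zero hB, hf.perm_eq_zero hC]

theorem IsAlternatingForm.exists_degenerate_of_radical (hf : IsAlternatingForm f)
    {K : Submodule ℂ D} (hK : Module.finrank ℂ K = 5) {r₁ r₂ : D} (hr₂ : r₂ ∈ K)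
    (h : ∀ y ∈ K, ∀ z ∈ K, f r₁ y z = 0 ∧ f r₂ y z = 0) (p q : D) :
    ∃ s t : ℂ, ¬(s = 0 ∧ t = 0) ∧ ∃ v ∈ K, v ∉ Submodule.span ℂ {r₁, r₂} ∧
      ∀ z, z ∈ K ∨ z = s • p + t • q → f r₁ r₂ z = 0 ∧ f v r₁ z = 0 ∧ f v r₂ z = 0 := by
  have : FiniteDimensional ℂ K := Module.finite_of_finrank_pos (by omega)
  obtain ⟨s, t, hst, h0⟩ : ∃ s t : ℂ, ¬(s = 0 ∧ t = 0) ∧ s * f r₁ r₂ p + t * f r₁ r₂ q = 0 := by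
    by_cases hq : f r₁ r₂ q = 0
    · exact ⟨0, 1, by simp, by simp [hq]⟩
    · exact ⟨f r₁ r₂ q, -f r₁ r₂ p, by simp [hq], by ring⟩
  set u := s • p + t • q with hu
  let g : K →ₗ[ℂ] Fin 2 → ℂ :=
    LinearMap.pi ![(f u r₁).comp K.subtype, (f u r₂).comp K.subtype]
  obtain ⟨v, hv, hvr⟩ : ∃ v ∈ (LinearMap.ker g).map K.subtype, v ∉ Submodule.span ℂ {r₁, r₂} := by
    classical
    by_contra! hle
    have h₁ := Submodule.finrank_mono (R := ℂ) (s := (LinearMap.ker g).map K.subtype)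
      (t := Submodule.span ℂ (({r₁, r₂} : Finset D) : Set D)) (fun x hx => by simpa using hle x hx)
    have h₂ := finrank_span_finset_le_card (R := ℂ) ({r₁, r₂} : Finset D)
    have h₃ : ({r₁, r₂} : Finset D).card ≤ 2 := Finset.card_le_two
    have h₄ := K.finrank_map_subtype_eq (LinearMap.ker g)
    have h₅ := g.finrank_range_add_finrank_ker
    have h₆ := (LinearMap.range g).finrank_le
    rw [Module.finrank_fin_fun] at h₆
    rw [Set.finrank] at h₂
    omega
  obtain ⟨w, hw, rfl⟩ := hv
  have hw₁ : f u r₁ w = 0 := congrFun (LinearMap.mem_ker.1 hw) 0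
  have hw₂ : f u r₂ w = 0 := congrFun (LinearMap.mem_ker.1 hw) 1
  refine ⟨s, t, hst, w, w.2, hvr, ?_⟩
  rintro z (hz | rfl)
  · rw [hf.swap_left w, hf.swap_left w]
    simp [h _ w.2 z hz, h _ hr₂ z hz]
  · rw [← hu]
    refine ⟨by simpa [hu] using h0, ?_, ?_⟩
    · rw [hf.rotate, hf.swap_left, hw₁, neg_zero]
    · rw [hf.rotate, hf.swap_left, hw₂, neg_zero]

theorem exists_relative_complement {A B : Submodule ℂ D} (h : A ≤ B) :
    ∃ C ≤ B, Disjoint A C ∧ A ⊔ C = B := by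
  obtain ⟨C, hC⟩ := A.exists_isCompl
  refine ⟨C ⊓ B, inf_le_right, hC.disjoint.mono_right inf_le_left, ?_⟩
  rw [← sup_inf_assoc_of_le C h, hC.sup_eq_top, top_inf_eq]

/-- An alternating form on a space of dimension three has a nonzero radical. -/
theorem IsAlternatingForm.exists_radical_vector (hf : IsAlternatingForm f) {G : Submodule ℂ D}
    (hG : Module.finrank ℂ G = 3) (ξ : D) : ∃ g ∈ G, g ≠ 0 ∧ ∀ z ∈ G, f ξ g z = 0 := by
  have : FiniteDimensional ℂ G := Module.finite_of_finrank_pos (by omega)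
  let b := Module.finBasisOfFinrankEq ℂ _ hG
  have hext : ∀ g : D, f ξ g (b 0) = 0 → f ξ g (b 1) = 0 → f ξ g (b 2) = 0 →
      ∀ z ∈ G, f ξ g z = 0 := by
    intro g h₀ h₁ h₂ z hz
    have e := congrArg (fun z : G => (z : D)) (b.sum_repr ⟨z, hz⟩)
    simp only [Fin.sum_univ_three, Submodule.coe_add, Submodule.coe_smul] at e
    rw [← e]
    simp [h₀, h₁, h₂]
  have s10 := hf.swap_right ξ (b 1) (b 0)
  have s20 := hf.swap_right ξ (b 2) (b 0)
  have s21 := hf.swap_right ξ (b 2) (b 1)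
  let w : G := f ξ (b 1) (b 2) • b 0 - f ξ (b 0) (b 2) • b 1 + f ξ (b 0) (b 1) • b 2
  by_cases hw : w = 0
  · have hli := Fintype.linearIndependent_iff.1 b.linearIndependent
      ![f ξ (b 1) (b 2), -f ξ (b 0) (b 2), f ξ (b 0) (b 1)]
      (by simpa [Fin.sum_univ_three, ← sub_eq_add_neg] using hw)
    refine ⟨b 0, (b 0).2, by simpa using b.ne_zero 0, hext _ (hf.right _ _) (hli 2) ?_⟩
    simpa using hli 1
  · refine ⟨w, w.2, by simpa using hw, hext _ ?_ ?_ ?_⟩ <;>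
      simp only [w, Submodule.coe_add, Submodule.coe_sub, Submodule.coe_smul, map_add, map_sub,
        map_smul, LinearMap.add_apply, LinearMap.sub_apply, LinearMap.smul_apply, smul_eq_mul,
        hf.right, s10, s20, s21] <;> ring

/-- A pencil of hyperplanes containing a five-dimensional space contains a member on which the
form degenerates. -/
theorem IsAlternatingForm.exists_degenerate (hf : IsAlternatingForm f) {K : Submodule ℂ D}
    (hK : Module.finrank ℂ K = 5) (p q : D) :
    ∃ s t : ℂ, ¬(s = 0 ∧ t = 0) ∧ ∃ u, u - (s • p + t • q) ∈ K ∧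
      ∃ r₁ ∈ K, ∃ r₂ ∈ K, ∃ v, LinearIndependent ℂ ![r₁, r₂] ∧
        (v - u ∈ K ∨ v ∈ K ∧ v ∉ Submodule.span ℂ {r₁, r₂}) ∧
        ∀ z, z ∈ K ∨ z = u → f r₁ r₂ z = 0 ∧ f v r₁ z = 0 ∧ f v r₂ z = 0 := by
  obtain ⟨r₁, hr₁, r₂, hr₂, hr, h⟩ | ⟨k, l₁, l₂, l₃, l₄, h⟩ := hf.exists_radical_or_isNormalForm hK
  · obtain ⟨s, t, hst, v, hv, hvr, H⟩ := hf.exists_degenerate_of_radical hK hr₂ h p q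
    exact ⟨s, t, hst, _, by simp, r₁, hr₁, r₂, hr₂, v, hr, .inr ⟨hv, hvr⟩, H⟩
  · obtain ⟨s, t, hst, u, hu, r₁, hr₁, r₂, hr₂, v, hr, hv, H⟩ := h.exists_degenerate hf p q
    exact ⟨s, t, hst, u, hu, r₁, hr₁, r₂, hr₂, v, hr, .inl hv, H⟩

theorem eq_zero_of_mem_span {S : Set D} {H : Submodule ℂ D}
    (h : ∀ a ∈ S, ∀ b ∈ S, ∀ z ∈ H, f a b z = 0) :
    ∀ x ∈ Submodule.span ℂ S, ∀ y ∈ Submodule.span ℂ S, ∀ z ∈ H, f x y z = 0 := by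
  intro x hx y hy z hz
  induction hx using Submodule.span_induction with
  | mem a ha =>
    induction hy using Submodule.span_induction with
    | mem b hb => exact h a ha b hb z hz
    | zero => simp
    | add _ _ _ _ h₁ h₂ => simp [h₁, h₂]
    | smul _ _ _ h₁ => simp [h₁]
  | zero => simp
  | add _ _ _ _ h₁ h₂ => simp [h₁, h₂]
  | smul _ _ _ h₁ => simp [h₁]

theorem IsAlternatingForm.exists_flag [FiniteDimensional ℂ D] (hf : IsAlternatingForm f) {ξ : D}
    (hξ : ξ ≠ 0) {F E : Submodule ℂ D} (hξF : ξ ∈ F) (hFE : F ≤ E)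
    (hF : Module.finrank ℂ F = 5) (hE : Module.finrank ℂ E = 8)
    (h : ∀ y ∈ F, ∀ z, f ξ y z = 0) :
    ∃ X H : Submodule ℂ D, X ≤ H ∧ H ≤ E ∧ Module.finrank ℂ X = 4 ∧ Module.finrank ℂ H = 7 ∧
      ∀ x ∈ X, ∀ y ∈ X, ∀ z ∈ H, f x y z = 0 := by
  have hadd : ∀ A B : Submodule ℂ D, Disjoint A B →
      Module.finrank ℂ ↥(A ⊔ B) = Module.finrank ℂ A + Module.finrank ℂ B := fun A B hAB => by
    have := Submodule.finrank_sup_add_finrank_inf_eq A B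
    rwa [hAB.eq_bot, finrank_bot, add_zero] at this
  -- Enlarge `F` to a six-dimensional `F'` orthogonal to `ξ`.
  obtain ⟨F', hFF', hF'E, hF', hξF'⟩ : ∃ F', F ≤ F' ∧ F' ≤ E ∧ Module.finrank ℂ F' = 6 ∧
      ∀ y ∈ F', ∀ z ∈ E, f ξ y z = 0 := by
    obtain ⟨G, hGE, hd, hs⟩ := exists_relative_complement hFE
    have hG : Module.finrank ℂ G = 3 := by
      have := hadd F G hd
      rw [hs] at this
      omega
    obtain ⟨g, hg, hg0, hgz⟩ := hf.exists_radical_vector hG ξ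
    have hgF : g ∉ F := fun hgF => hg0 (Submodule.disjoint_def.1 hd g hgF hg)
    refine ⟨F ⊔ Submodule.span ℂ {g}, le_sup_left, sup_le hFE ?_, ?_, ?_⟩
    · simpa using hGE hg
    · rw [Submodule.finrank_sup_span_singleton hgF, hF]
    · intro y hy z hz
      obtain ⟨y', hy', w, hw, rfl⟩ := Submodule.mem_sup.1 hy
      obtain ⟨c, rfl⟩ := Submodule.mem_span_singleton.1 hw
      rw [← hs] at hz
      obtain ⟨z', hz', w, hw, rfl⟩ := Submodule.mem_sup.1 hz
      have hgz' : f ξ g z' = 0 := by rw [hf.swap_right, h z' hz', neg_zero]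
      simp [h y' hy', hgz', hgz w hw]
  have hξF'm := hFF' hξF
  obtain ⟨K, hKF', hKd, hKs⟩ : ∃ K ≤ F', Disjoint (Submodule.span ℂ {ξ}) K ∧
      Submodule.span ℂ {ξ} ⊔ K = F' := exists_relative_complement (by simpa using hξF'm)
  have hK : Module.finrank ℂ K = 5 := by
    have := hadd _ K hKd
    rw [hKs, finrank_span_singleton hξ] at this
    omega
  have hξK : ξ ∉ K := fun hm =>
    hξ (Submodule.disjoint_def.1 hKd ξ (Submodule.mem_span_singleton_self ξ) hm)
  obtain ⟨M, hME, hMd, hMs⟩ := exists_relative_complement hF'E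
  have hM : Module.finrank ℂ M = 2 := by
    have := hadd F' M hMd
    rw [hMs] at this
    omega
  let b := Module.finBasisOfFinrankEq ℂ _ hM
  obtain ⟨s, t, hst, u, hu, r₁, hr₁, r₂, hr₂, v, hr, hv, H⟩ := hf.exists_degenerate hK (b 0) (b 1)
  have hw : s • (b 0 : D) + t • (b 1 : D) ∉ F' := fun hm => hst <| by
    have h0 := Submodule.disjoint_def.1 hMd _ hm
      (add_mem (M.smul_mem s (b 0).2) (M.smul_mem t (b 1).2))
    have := Fintype.linearIndependent_iff.1 b.linearIndependent ![s, t]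
      (Subtype.ext (by simpa [Fin.sum_univ_two] using h0))
    exact ⟨this 0, this 1⟩
  have huF' : u ∉ F' := fun hm => hw <| by simpa using sub_mem hm (hKF' hu)
  have huE : u ∈ E := by
    have := add_mem (hF'E (hKF' hu)) (hME (add_mem (M.smul_mem s (b 0).2) (M.smul_mem t (b 1).2)))
    simpa using this
  have hvE : v ∈ E := by
    rcases hv with hv | hv
    · simpa using add_mem (hF'E (hKF' hv)) huE
    · exact hF'E (hKF' hv.1)
  set R := Submodule.span ℂ {r₁, r₂} with hR
  have hRK : R ≤ K := Submodule.span_le.2 <| by rintro x (rfl | rfl) <;> assumption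
  have hRrank : Module.finrank ℂ R = 2 := by
    have := finrank_span_eq_card hr
    rwa [Matrix.range_cons, Matrix.range_cons, Matrix.range_empty, Set.union_empty,
      Set.singleton_union] at this
  have hvR : v ∉ R ⊔ Submodule.span ℂ {ξ} := by
    intro hm
    obtain ⟨r, hr, w, hw, hrw⟩ := Submodule.mem_sup.1 hm
    obtain ⟨c, rfl⟩ := Submodule.mem_span_singleton.1 hw
    rcases hv with hv | ⟨hvK, hvR⟩
    · have hvF' : v ∈ F' := hrw ▸ add_mem (hKF' (hRK hr)) (F'.smul_mem c hξF'm)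
      exact huF' (by simpa using sub_mem hvF' (hKF' hv))
    · have hc : c • ξ ∈ K := by
        have := sub_mem hvK (hRK hr)
        rwa [← hrw, add_sub_cancel_left] at this
      by_cases hc0 : c = 0
      · exact hvR (by rw [← hrw, hc0, zero_smul, add_zero]; exact hr)
      · exact hξK ((K.smul_mem_iff hc0).1 hc)
  have hX : Submodule.span ℂ {ξ, v, r₁, r₂} = (R ⊔ Submodule.span ℂ {ξ}) ⊔ Submodule.span ℂ {v} := by
    rw [Submodule.span_insert, Submodule.span_insert, ← hR]
    ac_rfl
  have hHind : ∀ g : D →ₗ[ℂ] ℂ, g ξ = 0 → (∀ z, z ∈ K ∨ z = u → g z = 0) →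
      ∀ z ∈ F' ⊔ Submodule.span ℂ {u}, g z = 0 := by
    intro g hg hz z hzH
    have : F' ⊔ Submodule.span ℂ {u} ≤ LinearMap.ker g := by
      rw [← hKs]
      refine sup_le (sup_le ?_ fun z hzK => hz z (.inl hzK)) ?_
      · simpa using hg
      · simpa using hz u (.inr rfl)
    exact this hzH
  have hHE : F' ⊔ Submodule.span ℂ {u} ≤ E := sup_le hF'E (by simpa using huE)
  refine ⟨Submodule.span ℂ {ξ, v, r₁, r₂}, F' ⊔ Submodule.span ℂ {u}, ?_, hHE, ?_, ?_, ?_⟩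
  · rw [hX]
    refine sup_le (sup_le ((hRK.trans hKF').trans le_sup_left) ?_) ?_
    · simpa using Submodule.mem_sup_left hξF'm
    · rw [Submodule.span_singleton_le_iff_mem]
      rcases hv with hv | hv
      · have := add_mem (Submodule.mem_sup_left (hKF' hv))
          (Submodule.mem_sup_right (Submodule.mem_span_singleton_self u) :
            u ∈ F' ⊔ Submodule.span ℂ {u})
        simpa using this
      · exact Submodule.mem_sup_left (hKF' hv.1)
  · have hξR : ξ ∉ R := fun hm => hξK (hRK hm)
    rw [hX, Submodule.finrank_sup_span_singleton hvR, Submodule.finrank_sup_span_singleton hξR,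
      hRrank]
  · rw [Submodule.finrank_sup_span_singleton huF', hF']
  have hξr : ∀ r ∈ K, ∀ z ∈ F' ⊔ Submodule.span ℂ {u}, f ξ r z = 0 :=
    fun r hr z hz => hξF' r (hKF' hr) z (hHE hz)
  have hξv : ∀ z ∈ F' ⊔ Submodule.span ℂ {u}, f ξ v z = 0 := by
    refine hHind (f ξ v) (hf.outer _ _) ?_
    rintro z (hz | rfl)
    · rw [hf.swap_right, hξF' z (hKF' hz) v hvE, neg_zero]
    · rcases hv with hv | hv
      · have := hξF' _ (hKF' hv) z huE
        rwa [map_sub, LinearMap.sub_apply, hf.right, sub_zero] at this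
      · exact hξF' v (hKF' hv.1) z huE
  have h12 := hHind (f r₁ r₂)
    (by rw [← hf.rotate]; exact hξF' _ (hKF' hr₁) _ (hF'E (hKF' hr₂))) fun z hz => (H z hz).1
  have hv1 := hHind (f v r₁)
    (by rw [← hf.rotate, hf.swap_right, hξF' _ (hKF' hr₁) _ hvE, neg_zero])
    fun z hz => (H z hz).2.1
  have hv2 := hHind (f v r₂)
    (by rw [← hf.rotate, hf.swap_right, hξF' _ (hKF' hr₂) _ hvE, neg_zero])
    fun z hz => (H z hz).2.2
  refine eq_zero_of_mem_span ?_
  intro x hx y hy z hz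
  have h₁ := hξr _ hr₁ z hz
  have h₂ := hξr _ hr₂ z hz
  have h₃ := hξv z hz
  have h₄ := h12 z hz
  have h₅ := hv1 z hz
  have h₆ := hv2 z hz
  rcases hx with rfl | rfl | rfl | rfl <;> rcases hy with rfl | rfl | rfl | rfl <;>
    first
      | exact hf.left _ _
      | assumption
      | (rw [hf.swap_left, neg_eq_zero]; assumption)

end TrilinearForms

section Contraction

variable {W : Type*} [AddCommGroup W] [Module ℂ W]

/-- The trilinear form `(x, y, z) ↦ z⌋(y⌋(x⌋ω))` on the dual space. -/
def contractionForm (ω : ExteriorAlgebra ℂ W) :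
    Module.Dual ℂ W →ₗ[ℂ] Module.Dual ℂ W →ₗ[ℂ] Module.Dual ℂ W →ₗ[ℂ] ℂ where
  toFun x := LinearMap.mk₂ ℂ
    (fun y z => algebraMapInv (CliffordAlgebra.contractLeft z
      (CliffordAlgebra.contractLeft y (CliffordAlgebra.contractLeft x ω))))
    (fun _ _ _ => by simp) (fun _ _ _ => by simp) (fun _ _ _ => by simp) (fun _ _ _ => by simp)
  map_add' _ _ := by ext; simp
  map_smul' _ _ := by ext; simp

theorem contractionForm_apply (ω : ExteriorAlgebra ℂ W) (x y z : Module.Dual ℂ W) :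
    contractionForm ω x y z = algebraMapInv (CliffordAlgebra.contractLeft z
      (CliffordAlgebra.contractLeft y (CliffordAlgebra.contractLeft x ω))) := rfl

theorem isAlternatingForm_contractionForm (ω : ExteriorAlgebra ℂ W) :
    IsAlternatingForm (contractionForm ω) where
  left x z := by
    rw [contractionForm_apply, CliffordAlgebra.contractLeft_contractLeft, map_zero, map_zero]
  right x y := by
    rw [contractionForm_apply, CliffordAlgebra.contractLeft_contractLeft, map_zero]

theorem contractionForm_mul (a b c : W) (x y z : Module.Dual ℂ W) :
    contractionForm (ι ℂ a * ι ℂ b * ι ℂ c) x y z =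
      x a * y b * z c - x a * y c * z b - x b * y a * z c + x b * y c * z a + x c * y a * z b
        - x c * y b * z a := by
  have hι : ∀ (d : Module.Dual ℂ W) (a : W), CliffordAlgebra.contractLeft d (ι ℂ a) =
      algebraMap ℂ (ExteriorAlgebra ℂ W) (d a) := fun d a => CliffordAlgebra.contractLeft_ι _ d a
  have hm : ∀ (d : Module.Dual ℂ W) (a : W) (b : ExteriorAlgebra ℂ W),
      CliffordAlgebra.contractLeft d (ι ℂ a * b) =
        d a • b - ι ℂ a * CliffordAlgebra.contractLeft d b :=
    fun d a b => CliffordAlgebra.contractLeft_ι_mul d a b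
  rw [contractionForm_apply, mul_assoc]
  simp only [hm, hι, map_sub, map_smul, Algebra.algebraMap_eq_smul_one, mul_smul_comm,
    mul_one, CliffordAlgebra.contractLeft_one, smul_zero, sub_zero, map_one, smul_eq_mul, mul_zero]
  ring

theorem induction_exteriorPower_three {p : ExteriorAlgebra ℂ W → Prop}
    (mul : ∀ a b c, p (ι ℂ a * ι ℂ b * ι ℂ c)) (zero : p 0) (add : ∀ x y, p x → p y → p (x + y))
    (smul : ∀ (r : ℂ) x, p x → p (r • x)) {ω : ExteriorAlgebra ℂ W} (hω : ω ∈ ⋀[ℂ]^3 W) : p ω := by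
  rw [← ιMulti_span_fixedDegree] at hω
  induction hω using Submodule.span_induction with
  | mem x hx =>
    obtain ⟨v, rfl⟩ := hx
    have := mul (v 0) (v 1) (v 2)
    rw [ιMulti_apply]
    simpa [List.ofFn_succ, mul_assoc] using this
  | zero => exact zero
  | add x y _ _ hx hy => exact add x y hx hy
  | smul r x _ hx => exact smul r x hx

/-- Expansion of a trivector in a basis. -/
theorem sum_contractionForm {I : Type*} [Fintype I] (b : Module.Basis I ℂ W)
    {ω : ExteriorAlgebra ℂ W} (hω : ω ∈ ⋀[ℂ]^3 W) :
    ∑ i, ∑ j, ∑ k, contractionForm ω (b.coord i) (b.coord j) (b.coord k) •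
      (ι ℂ (b i) * ι ℂ (b j) * ι ℂ (b k)) = (6 : ℂ) • ω := by
  have hexp : ∀ a c d : W, ∑ i, ∑ j, ∑ k, (b.coord i a * b.coord j c * b.coord k d) •
      (ι ℂ (b i) * ι ℂ (b j) * ι ℂ (b k)) = ι ℂ a * ι ℂ c * ι ℂ d := by
    intro a c d
    have hsum : ∀ e : W, ι ℂ e = ∑ i, b.coord i e • ι ℂ (b i) := fun e => by
      conv_lhs => rw [← b.sum_repr e]
      simp only [map_sum, map_smul, Module.Basis.coord_apply]
    rw [hsum a, hsum c, hsum d, Finset.sum_mul_sum, Finset.sum_mul]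
    refine Finset.sum_congr rfl fun i _ => ?_
    rw [Finset.sum_mul]
    refine Finset.sum_congr rfl fun j _ => ?_
    rw [Finset.mul_sum]
    refine Finset.sum_congr rfl fun k _ => ?_
    rw [smul_mul_smul_comm, smul_mul_smul_comm]
  have hswap : ∀ a c : W, ι ℂ a * ι ℂ c = -(ι ℂ c * ι ℂ a) := fun a c =>
    eq_neg_of_add_eq_zero_left (ι_add_mul_swap a c)
  refine induction_exteriorPower_three (p := fun ω => ∑ i, ∑ j, ∑ k,
    contractionForm ω (b.coord i) (b.coord j) (b.coord k) •
      (ι ℂ (b i) * ι ℂ (b j) * ι ℂ (b k)) = (6 : ℂ) • ω) ?_ ?_ ?_ ?_ hω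
  · intro x y z
    have h₁ : ι ℂ x * ι ℂ z * ι ℂ y = -(ι ℂ x * ι ℂ y * ι ℂ z) := by
      rw [mul_assoc, hswap z y, mul_neg, mul_assoc]
    have h₂ : ι ℂ y * ι ℂ x * ι ℂ z = -(ι ℂ x * ι ℂ y * ι ℂ z) := by
      rw [hswap y x, neg_mul]
    have h₃ : ι ℂ z * ι ℂ x * ι ℂ y = ι ℂ x * ι ℂ y * ι ℂ z := by
      rw [hswap z x, neg_mul, h₁, neg_neg]
    have h₄ : ι ℂ y * ι ℂ z * ι ℂ x = ι ℂ x * ι ℂ y * ι ℂ z := by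
      rw [mul_assoc, hswap z x, mul_neg, ← mul_assoc, h₂, neg_neg]
    have h₅ : ι ℂ z * ι ℂ y * ι ℂ x = -(ι ℂ x * ι ℂ y * ι ℂ z) := by
      rw [hswap z y, neg_mul, h₄]
    have e : ∀ i j k, contractionForm (ι ℂ x * ι ℂ y * ι ℂ z) (b.coord i) (b.coord j) (b.coord k) =
        b.coord i x * b.coord j y * b.coord k z - b.coord i x * b.coord j z * b.coord k y
        - b.coord i y * b.coord j x * b.coord k z + b.coord i z * b.coord j x * b.coord k y
        + b.coord i y * b.coord j z * b.coord k x - b.coord i z * b.coord j y * b.coord k x := by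
      intro i j k
      rw [contractionForm_mul]
      ring
    simp only [e, sub_smul, add_smul, Finset.sum_sub_distrib, Finset.sum_add_distrib, hexp, h₁, h₂,
      h₃, h₄, h₅]
    module
  · simp [contractionForm_apply]
  · intro x y hx hy
    simp only [contractionForm_apply, map_add, add_smul, Finset.sum_add_distrib, smul_add] at hx hy ⊢
    rw [hx, hy]
  · intro r x hx
    simp only [contractionForm_apply, map_smul, smul_assoc, ← Finset.smul_sum] at hx ⊢
    rw [hx, smul_comm]

end Contraction

section Flag

variable {W : Type*} [AddCommGroup W] [Module ℂ W]

/-- Every two-step flag has an adapted basis. -/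
theorem exists_basis_adapted_to_flag [FiniteDimensional ℂ W] {S T : Submodule ℂ W} (hST : S ≤ T) :
    ∃ (u : Set W) (_ : Fintype u) (b : Module.Basis u ℂ W),
      (∀ i, b i ∈ S ∨ b.coord i ∈ S.dualAnnihilator) ∧
        ∀ i, b i ∈ T ∨ b.coord i ∈ T.dualAnnihilator := by
  obtain ⟨s, hsS, -, hSs, hs⟩ := exists_linearIndepOn_extension (K := ℂ) (v := id)
    (linearIndepOn_empty ℂ _) (Set.empty_subset (S : Set W))
  obtain ⟨t, htT, hst, hTt, ht⟩ := exists_linearIndepOn_extension (K := ℂ) (v := id) hs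
    (hsS.trans hST)
  obtain ⟨u, -, htu, hu, hli⟩ := exists_linearIndepOn_extension (K := ℂ) (v := id) ht
    (Set.subset_univ t)
  simp only [Set.image_id] at hSs hTt hu
  have : Fintype u := hli.linearIndependent.setFinite.fintype
  let b : Module.Basis u ℂ W := .mk hli fun x _ => by simpa using hu (Set.mem_univ x)
  have hb : ∀ i, b i = i := fun i => by simp [b]
  have key : ∀ (r : Set W) (R : Submodule ℂ W), r ⊆ u → r ⊆ R → (R : Set W) ⊆ Submodule.span ℂ r →
      ∀ i, b i ∈ R ∨ b.coord i ∈ R.dualAnnihilator := by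
    intro r R hru hrR hRr i
    by_cases hi : (i : W) ∈ r
    · exact .inl (hb i ▸ hrR hi)
    · refine .inr ((Submodule.mem_dualAnnihilator _).2 fun x hx => ?_)
      refine (Submodule.span_le (p := LinearMap.ker (b.coord i))).2 (fun v hv => ?_) (hRr hx)
      have hne : (⟨v, hru hv⟩ : u) ≠ i := fun h => hi (h ▸ hv)
      have := b.coord_apply i (b ⟨v, hru hv⟩)
      rw [Module.Basis.repr_self, Finsupp.single_eq_of_ne hne.symm, hb] at this
      exact this
  exact ⟨u, this, b, key s S (hst.trans htu) hsS hSs, key t T htu htT hTt⟩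

theorem contractionForm_eq_zero_of_mem_wSpan2 {P : Submodule ℂ V9} {ω : ExteriorAlgebra ℂ V9}
    {ξ : Module.Dual ℂ V9} (h : CliffordAlgebra.contractLeft ξ ω ∈ wSpan2 P)
    {y : Module.Dual ℂ V9} (hy : y ∈ P.dualAnnihilator) (z : Module.Dual ℂ V9) :
    contractionForm ω ξ y z = 0 := by
  rw [Submodule.mem_dualAnnihilator] at hy
  suffices CliffordAlgebra.contractLeft y (CliffordAlgebra.contractLeft ξ ω) = 0 by
    rw [contractionForm_apply, this, map_zero, map_zero]
  refine (Submodule.span_le (p := LinearMap.ker (CliffordAlgebra.contractLeft y))).2 ?_ h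
  rintro _ ⟨s, hs, t, ht, rfl⟩
  have hι : CliffordAlgebra.contractLeft y (ι ℂ t) = algebraMap ℂ (ExteriorAlgebra ℂ V9) (y t) :=
    CliffordAlgebra.contractLeft_ι _ y t
  have hm := CliffordAlgebra.contractLeft_ι_mul (Q := (0 : QuadraticForm ℂ V9)) y s (ι ℂ t)
  rw [hι, hy s hs, hy t ht, map_zero, mul_zero, zero_smul, sub_zero] at hm
  exact hm

theorem mem_wSpan_sup_wSpan {S T : Submodule ℂ V9} (hST : S ≤ T) {ω : ExteriorAlgebra ℂ V9}
    (hω : ω ∈ ⋀[ℂ]^3 V9)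
    (h : ∀ x ∈ T.dualAnnihilator, ∀ y ∈ T.dualAnnihilator, ∀ z ∈ S.dualAnnihilator,
      contractionForm ω x y z = 0) :
    ω ∈ wSpan S ⊤ ⊤ ⊔ wSpan ⊤ T T := by
  have hf := isAlternatingForm_contractionForm ω
  obtain ⟨I, _, b, hS, hT⟩ := exists_basis_adapted_to_flag hST
  have hswap : ∀ a c : V9, ι ℂ a * ι ℂ c = -(ι ℂ c * ι ℂ a) := fun a c =>
    eq_neg_of_add_eq_zero_left (ι_add_mul_swap a c)
  have hrot : ∀ x y z : V9, ι ℂ x * ι ℂ y * ι ℂ z = ι ℂ y * ι ℂ z * ι ℂ x := fun x y z => by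
    rw [mul_assoc (ι ℂ y), hswap z x, mul_neg, ← mul_assoc, hswap y x, neg_mul, neg_neg]
  have mem₁ : ∀ s ∈ S, ∀ x y, ι ℂ s * ι ℂ x * ι ℂ y ∈ wSpan S ⊤ ⊤ ⊔ wSpan ⊤ T T := fun s hs x y =>
    Submodule.mem_sup_left (Submodule.subset_span ⟨s, hs, x, trivial, y, trivial, rfl⟩)
  have mem₂ : ∀ x, ∀ s ∈ T, ∀ t ∈ T, ι ℂ x * ι ℂ s * ι ℂ t ∈ wSpan S ⊤ ⊤ ⊔ wSpan ⊤ T T :=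
    fun x s hs t ht =>
      Submodule.mem_sup_right (Submodule.subset_span ⟨x, trivial, s, hs, t, ht, rfl⟩)
  have h6 : ω = (6 : ℂ)⁻¹ • (6 : ℂ) • ω := by rw [smul_smul]; norm_num
  rw [h6, ← sum_contractionForm b hω]
  refine Submodule.smul_mem _ _ (Submodule.sum_mem _ fun i _ => Submodule.sum_mem _ fun j _ =>
    Submodule.sum_mem _ fun k _ => ?_)
  rcases hS i with hi | hi
  · exact Submodule.smul_mem _ _ (mem₁ _ hi _ _)
  rcases hS j with hj | hj
  · exact Submodule.smul_mem _ _ (hrot (b i) _ _ ▸ mem₁ _ hj _ _)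
  rcases hS k with hk | hk
  · exact Submodule.smul_mem _ _ (hrot (b k) _ _ ▸ mem₁ _ hk _ _)
  rcases hT i with hi' | hi' <;> rcases hT j with hj' | hj' <;> rcases hT k with hk' | hk'
  · exact Submodule.smul_mem _ _ (mem₂ _ _ hj' _ hk')
  · exact Submodule.smul_mem _ _ (hrot (b k) _ _ ▸ mem₂ _ _ hi' _ hj')
  · exact Submodule.smul_mem _ _ (hrot (b i) _ _ ▸ mem₂ _ _ hk' _ hi')
  · rw [hf.rotate, h _ hj' _ hk' _ hi, zero_smul]
    exact Submodule.zero_mem _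
  · exact Submodule.smul_mem _ _ (mem₂ _ _ hj' _ hk')
  · rw [← hf.rotate, h _ hk' _ hi' _ hj, zero_smul]
    exact Submodule.zero_mem _
  · rw [h _ hi' _ hj' _ hk, zero_smul]
    exact Submodule.zero_mem _
  · rw [h _ hi' _ hj' _ hk, zero_smul]
    exact Submodule.zero_mem _

end Flag

theorem D_Y3_covered_by_P3s :
    ∃ p : (⋀[ℂ]^3 V9) → ℂ, IsPolyFun p ∧ p ≠ 0 ∧
      ∀ ω : ⋀[ℂ]^3 V9, p ω ≠ 0 →
        ∀ ξ : Module.Dual ℂ V9, ξ ≠ 0 →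
          ∀ P₄ : Submodule ℂ V9, P₄ ≤ LinearMap.ker ξ → Module.finrank ℂ P₄ = 4 →
            CliffordAlgebra.contractLeft ξ (ω : ExteriorAlgebra ℂ V9) ∈ wSpan2 P₄ →
              ∀ V₁ : Submodule ℂ V9, V₁ ≤ P₄ → Module.finrank ℂ V₁ = 1 →
                ∃ U₂ U₅ : Submodule ℂ V9,
                  Module.finrank ℂ U₂ = 2 ∧ Module.finrank ℂ U₅ = 5 ∧
                  V₁ ≤ U₂ ∧ U₂ ≤ U₅ ∧
                  (ω : ExteriorAlgebra ℂ V9) ∈ wSpan U₂ ⊤ ⊤ ⊔ wSpan ⊤ U₅ U₅ := by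
  refine ⟨1, Subalgebra.one_mem _, one_ne_zero, fun ω _ ξ hξ P hPξ hP hω V hVP hV => ?_⟩
  have h9 : Module.finrank ℂ V9 = 9 := by simp
  have hPF := Subspace.finrank_add_finrank_dualAnnihilator_eq P
  have hVE := Subspace.finrank_add_finrank_dualAnnihilator_eq V
  obtain ⟨X, H, hXH, hHE, hX, hH, hf⟩ :=
    (isAlternatingForm_contractionForm (ω : ExteriorAlgebra ℂ V9)).exists_flag hξ
      (F := P.dualAnnihilator) (E := V.dualAnnihilator)
      ((Submodule.mem_dualAnnihilator _).2 fun x hx => hPξ hx)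
      (Submodule.dualAnnihilator_anti hVP) (by omega) (by omega)
      fun y hy z => contractionForm_eq_zero_of_mem_wSpan2 hω hy z
  have hU₂ := Subspace.finrank_add_finrank_dualCoannihilator_eq H
  have hU₅ := Subspace.finrank_add_finrank_dualCoannihilator_eq X
  have hUU := Submodule.dualCoannihilator_anti hXH
  refine ⟨H.dualCoannihilator, X.dualCoannihilator, by omega, by omega, ?_, hUU,
    mem_wSpan_sup_wSpan hUU ω.2 ?_⟩
  · exact Submodule.le_dualAnnihilator_iff_le_dualCoannihilator.1 hHE
  · rw [Subspace.dualCoannihilator_dualAnnihilator_eq, Subspace.dualCoannihilator_dualAnnihilator_eq]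
    exact hf
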